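/- Let q : SO(3) → S² be the quotient map A ↦ A·e₃ sending a rotation matrix to the image of the fixed unit vector e₃ = (0,0,1), and let σ : S² → S² be a continuous map. Then σ admits a continuous lift σ̂ : S² → SO(3) with q ∘ σ̂ = σ if and only if σ is homotopic to a constant map. -/

import Mathlib

open Matrix

/-- The symmetric matrix `vvᵀ`, where `v` is either of the two unit quaternions which represent the
rotation `A`. -/
noncomputable def quaternionMatrix (A : Matrix (Fin 3) (Fin 3) ℝ) : Matrix (Fin 4) (Fin 4) ℝ :=
  (1 / 4 : ℝ) •
    !![1 + A 0 0 + A 1 1 + A 2 2, A 2 1 - A 1 2, A 0 2 - A 2 0, A 1 0 - A 0 1;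
      A 2 1 - A 1 2, 1 + A 0 0 - A 1 1 - A 2 2, A 1 0 + A 0 1, A 0 2 + A 2 0;
      A 0 2 - A 2 0, A 1 0 + A 0 1, 1 - A 0 0 + A 1 1 - A 2 2, A 2 1 + A 1 2;
      A 1 0 - A 0 1, A 0 2 + A 2 0, A 2 1 + A 1 2, 1 - A 0 0 - A 1 1 + A 2 2]

theorem adjugate_of_mem_specialOrthogonalGroup {A : Matrix (Fin 3) (Fin 3) ℝ}
    (hA : A ∈ specialOrthogonalGroup (Fin 3) ℝ) :
    A.adjugate = Aᵀ := by
  rw [mem_specialOrthogonalGroup_iff, mem_orthogonalGroup_iff] at hA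
  calc A.adjugate = A.adjugate * (A * Aᵀ) := by rw [hA.1, mul_one]
    _ = Aᵀ := by rw [← mul_assoc, adjugate_mul, hA.2, one_smul, one_mul]

theorem quaternionMatrix_symm (A : Matrix (Fin 3) (Fin 3) ℝ) (i j : Fin 4) :
    quaternionMatrix A i j = quaternionMatrix A j i := by
  fin_cases i <;> fin_cases j <;> simp [quaternionMatrix]

theorem trace_quaternionMatrix (A : Matrix (Fin 3) (Fin 3) ℝ) :
    (quaternionMatrix A).trace = 1 := by
  simp [quaternionMatrix, Matrix.trace, Fin.sum_univ_four]
  ring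

set_option maxHeartbeats 1000000 in
theorem quaternionMatrix_minor_of_lt {A : Matrix (Fin 3) (Fin 3) ℝ}
    (hA : A ∈ specialOrthogonalGroup (Fin 3) ℝ) {i j k l : Fin 4} (hil : i < l) (hjk : j < k) :
    quaternionMatrix A i k * quaternionMatrix A j l =
      quaternionMatrix A i j * quaternionMatrix A k l := by
  have h_adj := adjugate_of_mem_specialOrthogonalGroup hA
  rw [mem_specialOrthogonalGroup_iff, mem_orthogonalGroup_iff] at hA
  have h_rows := hA.1
  have h_cols := mul_eq_one_comm.1 h_rows
  rw [adjugate_fin_three] at h_adj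
  simp only [← Matrix.ext_iff, Fin.forall_fin_succ, Matrix.mul_apply, Fin.sum_univ_three,
    transpose_apply] at h_adj h_rows h_cols
  simp at h_adj h_rows h_cols
  obtain ⟨⟨_, _, _⟩, ⟨_, _, _⟩, _, _, _⟩ := h_adj
  obtain ⟨⟨_, _, _⟩, ⟨-, _, _⟩, -, -, _⟩ := h_rows
  obtain ⟨⟨_, _, _⟩, ⟨-, _, _⟩, -, -, _⟩ := h_cols
  clear hA
  fin_cases i <;> fin_cases l <;> (try exact absurd hil (by decide)) <;>
    fin_cases j <;> fin_cases k <;> (try exact absurd hjk (by decide)) <;>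
    simp [quaternionMatrix] <;> linarith

/-- The quaternion matrix of a rotation has rank one. -/
theorem quaternionMatrix_minor {A : Matrix (Fin 3) (Fin 3) ℝ}
    (hA : A ∈ specialOrthogonalGroup (Fin 3) ℝ) (i j k l : Fin 4) :
    quaternionMatrix A i k * quaternionMatrix A j l =
      quaternionMatrix A i j * quaternionMatrix A k l := by
  have h_symm := quaternionMatrix_symm A
  rcases lt_trichotomy i l with hil | rfl | hil
  · rcases lt_trichotomy j k with hjk | rfl | hjk
    · exact quaternionMatrix_minor_of_lt hA hil hjk
    · rfl
    · exact (quaternionMatrix_minor_of_lt hA hil hjk).symm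
  · rw [h_symm i k, h_symm j i, mul_comm]
  · rcases lt_trichotomy j k with hjk | rfl | hjk
    · have := quaternionMatrix_minor_of_lt hA hil hjk
      rw [h_symm i k, h_symm j l, h_symm i j, h_symm k l]
      linarith
    · rfl
    · have := quaternionMatrix_minor_of_lt hA hil hjk
      rw [h_symm i k, h_symm j l, h_symm i j, h_symm k l]
      linarith

theorem continuous_quaternionMatrix : Continuous quaternionMatrix := by
  refine continuous_matrix fun i j => ?_
  fin_cases i <;> fin_cases j <;> simp [quaternionMatrix] <;> fun_prop

/-- A property of maps out of a compact space which is inherited by maps close enough to a map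
having it is invariant under homotopy. -/
theorem ContinuousMap.Homotopic.of_forall_mem {X Y : Type*} [TopologicalSpace X] [CompactSpace X]
    [TopologicalSpace Y] {Q : C(X, Y) → Prop} {R : Set (Y × Y)} (hR : IsOpen R)
    (h_diag : ∀ y, (y, y) ∈ R)
    (h_step : ∀ f g : C(X, Y), (∀ x, (f x, g x) ∈ R) → Q f → Q g)
    {f g : C(X, Y)} (hfg : f.Homotopic g) (hf : Q f) : Q g := by
  obtain ⟨H⟩ := hfg
  have h_near (t : unitInterval) :
      ∀ᶠ s in nhds t, ∀ x : X, (H (s, x), H (t, x)) ∈ R ∧ (H (t, x), H (s, x)) ∈ R := by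
    have := isCompact_univ.eventually_forall_of_forall_eventually (x₀ := t)
      (K := (Set.univ : Set X))
      (P := fun s x => (H (s, x), H (t, x)) ∈ R ∧ (H (t, x), H (s, x)) ∈ R) fun x _ => by
        have h1 : Continuous fun z : unitInterval × X => (H z, H (t, z.2)) := by fun_prop
        have h2 : Continuous fun z : unitInterval × X => (H (t, z.2), H z) := by fun_prop
        exact (h1.continuousAt.eventually_mem (hR.mem_nhds (h_diag _))).and
          (h2.continuousAt.eventually_mem (hR.mem_nhds (h_diag _)))
    simpa using this
  have h_loc : IsLocallyConstant fun t : unitInterval => Q (H.curry t) := by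
    rw [IsLocallyConstant.iff_eventually_eq]
    intro t
    filter_upwards [h_near t] with s hs
    exact propext ⟨h_step _ _ fun x => (hs x).1, h_step _ _ fun x => (hs x).2⟩
  have h01 := h_loc.apply_eq_of_preconnectedSpace 0 1
  have h0 : H.curry 0 = f := by ext x; simp
  have h1 : H.curry 1 = g := by ext x; simp
  simp only [h0, h1] at h01
  exact h01 ▸ hf

theorem vecMulVec_self_eq_quaternionMatrix {A : Matrix (Fin 3) (Fin 3) ℝ}
    (hA : A ∈ specialOrthogonalGroup (Fin 3) ℝ) {v : Fin 4 → ℝ}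
    (hv : 0 < v ⬝ᵥ quaternionMatrix A *ᵥ v) :
    vecMulVec ((√(v ⬝ᵥ quaternionMatrix A *ᵥ v))⁻¹ • quaternionMatrix A *ᵥ v)
      ((√(v ⬝ᵥ quaternionMatrix A *ᵥ v))⁻¹ • quaternionMatrix A *ᵥ v) = quaternionMatrix A := by
  have key : vecMulVec (quaternionMatrix A *ᵥ v) (quaternionMatrix A *ᵥ v) =
      (v ⬝ᵥ quaternionMatrix A *ᵥ v) • quaternionMatrix A := by
    ext i j
    simp only [vecMulVec_apply, mulVec, dotProduct, Matrix.smul_apply, smul_eq_mul,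
      Finset.sum_mul, Finset.mul_sum]
    rw [Finset.sum_comm]
    refine Finset.sum_congr rfl fun k _ => Finset.sum_congr rfl fun l _ => ?_
    linear_combination v k * v l * quaternionMatrix_minor hA i j k l
  have h_sq := Real.mul_self_sqrt hv.le
  have h_ne := (Real.sqrt_pos.2 hv).ne'
  rw [smul_vecMulVec, vecMulVec_smul, key, smul_smul, smul_smul]
  convert one_smul ℝ _
  field_simp
  rw [sq, h_sq]

/-- A map to `SO(3)` lifts to unit quaternions if so does a map which is close to it. -/
theorem exists_quaternion_lift_of_forall_pos {X : Type*} [TopologicalSpace X]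
    (f g : C(X, specialOrthogonalGroup (Fin 3) ℝ))
    (hfg : ∀ x, 0 < (quaternionMatrix (f x) * quaternionMatrix (g x)).trace)
    (hf : ∃ v : C(X, Fin 4 → ℝ), ∀ x, vecMulVec (v x) (v x) = quaternionMatrix (f x)) :
    ∃ v : C(X, Fin 4 → ℝ), ∀ x, vecMulVec (v x) (v x) = quaternionMatrix (g x) := by
  obtain ⟨v, hv⟩ := hf
  have h_pos (x : X) : 0 < v x ⬝ᵥ quaternionMatrix (g x) *ᵥ v x := by
    have := hfg x
    rwa [← hv, vecMulVec_mul, trace_vecMulVec, dotProduct_comm, ← dotProduct_mulVec] at this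
  have h_g : Continuous fun x => quaternionMatrix (g x) :=
    continuous_quaternionMatrix.comp (continuous_subtype_val.comp g.continuous)
  have h_mul : Continuous fun x => quaternionMatrix (g x) *ᵥ v x := h_g.matrix_mulVec v.continuous
  have h_dot : Continuous fun x => v x ⬝ᵥ quaternionMatrix (g x) *ᵥ v x :=
    v.continuous.dotProduct h_mul
  exact ⟨⟨fun x => (√(v x ⬝ᵥ quaternionMatrix (g x) *ᵥ v x))⁻¹ • quaternionMatrix (g x) *ᵥ v x,
    (h_dot.sqrt.inv₀ fun x => (Real.sqrt_pos.2 (h_pos x)).ne').smul h_mul⟩,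
    fun x => vecMulVec_self_eq_quaternionMatrix (g x).2 (h_pos x)⟩

theorem exists_vecMulVec_self_eq_quaternionMatrix {A : Matrix (Fin 3) (Fin 3) ℝ}
    (hA : A ∈ specialOrthogonalGroup (Fin 3) ℝ) :
    ∃ v : Fin 4 → ℝ, vecMulVec v v = quaternionMatrix A := by
  obtain ⟨i, -, hi⟩ : ∃ i ∈ Finset.univ, 0 < quaternionMatrix A i i :=
    Finset.exists_lt_of_sum_lt (f := fun _ => (0 : ℝ)) <| by
      have := trace_quaternionMatrix A
      simp only [trace, diag_apply] at this
      simp [this]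
  refine ⟨_, vecMulVec_self_eq_quaternionMatrix hA (v := Pi.single i 1) ?_⟩
  simpa using hi

theorem trace_quaternionMatrix_mul_self {A : Matrix (Fin 3) (Fin 3) ℝ}
    (hA : A ∈ specialOrthogonalGroup (Fin 3) ℝ) :
    (quaternionMatrix A * quaternionMatrix A).trace = 1 := by
  obtain ⟨v, hv⟩ := exists_vecMulVec_self_eq_quaternionMatrix hA
  have h_tr := trace_quaternionMatrix A
  rw [← hv, trace_vecMulVec] at h_tr
  rw [← hv, vecMulVec_mul_vecMulVec, h_tr, one_smul, trace_vecMulVec, h_tr]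

theorem isOpen_setOf_trace_quaternionMatrix_mul_pos :
    IsOpen {p : specialOrthogonalGroup (Fin 3) ℝ × specialOrthogonalGroup (Fin 3) ℝ |
      0 < (quaternionMatrix p.1 * quaternionMatrix p.2).trace} := by
  have h_fst := continuous_quaternionMatrix.comp (continuous_subtype_val.comp
    (continuous_fst (X := specialOrthogonalGroup (Fin 3) ℝ)
      (Y := specialOrthogonalGroup (Fin 3) ℝ)))
  have h_snd := continuous_quaternionMatrix.comp (continuous_subtype_val.comp
    (continuous_snd (X := specialOrthogonalGroup (Fin 3) ℝ)
      (Y := specialOrthogonalGroup (Fin 3) ℝ)))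
  exact isOpen_lt continuous_const (h_fst.matrix_mul h_snd).matrix_trace

/-- Maps from a compact contractible space to `SO(3)` lift to unit quaternions. -/
theorem exists_quaternion_lift_of_contractible {X : Type*} [TopologicalSpace X] [CompactSpace X]
    [ContractibleSpace X] (f : C(X, specialOrthogonalGroup (Fin 3) ℝ)) :
    ∃ v : C(X, Fin 4 → ℝ), ∀ x, vecMulVec (v x) (v x) = quaternionMatrix (f x) := by
  obtain ⟨A, hA⟩ := (id_nullhomotopic X).comp_right f
  rw [ContinuousMap.comp_id] at hA
  obtain ⟨v, hv⟩ := exists_vecMulVec_self_eq_quaternionMatrix A.2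
  exact ContinuousMap.Homotopic.of_forall_mem (Y := specialOrthogonalGroup (Fin 3) ℝ)
    (Q := fun f => ∃ v : C(X, Fin 4 → ℝ), ∀ x, vecMulVec (v x) (v x) = quaternionMatrix (f x))
    isOpen_setOf_trace_quaternionMatrix_mul_pos
    (fun B => one_pos.trans_eq (trace_quaternionMatrix_mul_self B.2).symm)
    exists_quaternion_lift_of_forall_pos hA.symm ⟨.const X v, fun _ => hv⟩

theorem EuclideanSpace.mem_sphere_zero_one_fin_three {x : EuclideanSpace ℝ (Fin 3)} :
    x ∈ Metric.sphere (0 : EuclideanSpace ℝ (Fin 3)) 1 ↔ x 0 ^ 2 + x 1 ^ 2 + x 2 ^ 2 = 1 := by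
  simp [EuclideanSpace.norm_eq, Fin.sum_univ_three]

theorem norm_sq_le_one_of_mem_closedBall
    (u : Metric.closedBall (0 : EuclideanSpace ℝ (Fin 2)) 1) :
    u.1 0 ^ 2 + u.1 1 ^ 2 ≤ 1 := by
  have h := u.2
  rw [mem_closedBall_zero_iff, ← sq_le_one_iff₀ (norm_nonneg _), EuclideanSpace.real_norm_sq_eq,
    Fin.sum_univ_two] at h
  exact h

/-- The map from the closed disk onto the sphere which collapses the boundary circle to the south
pole. -/
noncomputable def diskToSphere : C(Metric.closedBall (0 : EuclideanSpace ℝ (Fin 2)) 1,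
    Metric.sphere (0 : EuclideanSpace ℝ (Fin 3)) 1) where
  toFun u := ⟨!₂[2 * √(1 - (u.1 0 ^ 2 + u.1 1 ^ 2)) * u.1 0,
    2 * √(1 - (u.1 0 ^ 2 + u.1 1 ^ 2)) * u.1 1, 1 - 2 * (u.1 0 ^ 2 + u.1 1 ^ 2)], by
      have h := Real.sq_sqrt (sub_nonneg.2 (norm_sq_le_one_of_mem_closedBall u))
      rw [EuclideanSpace.mem_sphere_zero_one_fin_three]
      simp only [cons_val]
      linear_combination 4 * (u.1 0 ^ 2 + u.1 1 ^ 2) * h⟩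
  continuous_toFun := by
    refine Continuous.subtype_mk ?_ _
    refine (PiLp.continuous_toLp 2 _).comp (continuous_pi fun i => ?_)
    fin_cases i <;> simp <;> fun_prop

theorem diskToSphere_surjective : Function.Surjective diskToSphere := by
  rintro ⟨x, hx⟩
  have hx' := EuclideanSpace.mem_sphere_zero_one_fin_three.1 hx
  rcases eq_or_ne (x 2) (-1) with h | h
  · have h0 : x 0 = 0 := by nlinarith [sq_nonneg (x 0), sq_nonneg (x 1)]
    have h1 : x 1 = 0 := by nlinarith [sq_nonneg (x 0), sq_nonneg (x 1)]
    refine ⟨⟨!₂[1, 0], by simp [EuclideanSpace.norm_eq]⟩, Subtype.ext ?_⟩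
    ext i
    fin_cases i <;> simp [diskToSphere, h, h0, h1]
    norm_num
  · have h_pos : 0 < (1 + x 2) / 2 := by
      have : -1 ≤ x 2 := by nlinarith [sq_nonneg (x 0), sq_nonneg (x 1)]
      have := lt_of_le_of_ne this h.symm
      linarith
    set s := √((1 + x 2) / 2) with hs
    have h_sq : s ^ 2 = (1 + x 2) / 2 := Real.sq_sqrt h_pos.le
    have h_ne : s ≠ 0 := (Real.sqrt_pos.2 h_pos).ne'
    have h_norm : (x 0 / (2 * s)) ^ 2 + (x 1 / (2 * s)) ^ 2 = (1 - x 2) / 2 := by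
      field_simp
      rw [h_sq]
      linear_combination hx'
    have h_root : √(1 - (1 - x 2) / 2) = s := by
      rw [hs]
      ring_nf
    refine ⟨⟨!₂[x 0 / (2 * s), x 1 / (2 * s)], ?_⟩, Subtype.ext ?_⟩
    · rw [mem_closedBall_zero_iff, ← sq_le_one_iff₀ (norm_nonneg _),
        EuclideanSpace.real_norm_sq_eq, Fin.sum_univ_two]
      simp only [cons_val, h_norm]
      nlinarith [sq_nonneg (x 0), sq_nonneg (x 1)]
    · ext i
      fin_cases i <;> simp [diskToSphere, h_norm, h_root]
      · field_simp
      · field_simp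
      · ring

theorem eq_or_norm_eq_one_of_diskToSphere_eq
    {u w : Metric.closedBall (0 : EuclideanSpace ℝ (Fin 2)) 1}
    (h : diskToSphere u = diskToSphere w) : u = w ∨ ‖u.1‖ = 1 ∧ ‖w.1‖ = 1 := by
  have h' := congrArg (fun z : Metric.sphere (0 : EuclideanSpace ℝ (Fin 3)) 1 => z.1) h
  have h0 := congrArg (fun z : EuclideanSpace ℝ (Fin 3) => z 0) h'
  have h1 := congrArg (fun z : EuclideanSpace ℝ (Fin 3) => z 1) h'
  have h2 := congrArg (fun z : EuclideanSpace ℝ (Fin 3) => z 2) h'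
  simp [diskToSphere] at h0 h1 h2
  rw [h2] at h0 h1
  have h_le := norm_sq_le_one_of_mem_closedBall w
  rcases h_le.eq_or_lt with h_eq | h_lt
  · right
    constructor <;> rw [← sq_eq_sq₀ (norm_nonneg _) zero_le_one, EuclideanSpace.real_norm_sq_eq,
      Fin.sum_univ_two] <;> linarith
  · left
    have h_ne := (Real.sqrt_pos.2 (sub_pos.2 h_lt)).ne'
    refine Subtype.ext ?_
    ext i
    fin_cases i
    · exact mul_left_cancel₀ (mul_ne_zero two_ne_zero h_ne) h0
    · exact mul_left_cancel₀ (mul_ne_zero two_ne_zero h_ne) h1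

theorem diskToSphere_eq_of_norm_eq_one
    {u w : Metric.closedBall (0 : EuclideanSpace ℝ (Fin 2)) 1} (hu : ‖u.1‖ = 1) (hw : ‖w.1‖ = 1) :
    diskToSphere u = diskToSphere w := by
  rw [← sq_eq_sq₀ (norm_nonneg _) zero_le_one, EuclideanSpace.real_norm_sq_eq, Fin.sum_univ_two,
    one_pow] at hu hw
  refine Subtype.ext ?_
  simp [diskToSphere, hu, hw]

theorem eq_of_vecMulVec_self_eq {u v : Fin 4 → ℝ} (h : vecMulVec u u = vecMulVec v v)
    (huv : u ⬝ᵥ v = 1) (hv : v ⬝ᵥ v = 1) : u = v := by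
  have := congrArg (· *ᵥ v) h
  simpa [vecMulVec_mulVec, huv, hv] using this

theorem dotProduct_sq_eq_one_of_vecMulVec_self_eq {u v : Fin 4 → ℝ}
    (h : vecMulVec u u = vecMulVec v v) (hv : v ⬝ᵥ v = 1) : (u ⬝ᵥ v) ^ 2 = 1 := by
  have := congrArg (fun M => v ⬝ᵥ M *ᵥ v) h
  simp only [vecMulVec_mulVec, hv, dotProduct_smul, op_smul_eq_smul, smul_eq_mul, mul_one] at this
  rw [sq, ← this, dotProduct_comm v]

/-- Maps from the two-sphere to `SO(3)` lift to unit quaternions. -/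
theorem exists_quaternion_lift_of_sphere
    (f : C(Metric.sphere (0 : EuclideanSpace ℝ (Fin 3)) 1, specialOrthogonalGroup (Fin 3) ℝ)) :
    ∃ v : C(Metric.sphere (0 : EuclideanSpace ℝ (Fin 3)) 1, Fin 4 → ℝ),
      ∀ x, vecMulVec (v x) (v x) = quaternionMatrix (f x) := by
  have : ContractibleSpace (Metric.closedBall (0 : EuclideanSpace ℝ (Fin 2)) 1) :=
    (convex_closedBall _ _).contractibleSpace (by simp)
  obtain ⟨v, hv⟩ := exists_quaternion_lift_of_contractible (f.comp diskToSphere)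
  have h_unit (u) : v u ⬝ᵥ v u = 1 := by
    have := trace_quaternionMatrix (f (diskToSphere u))
    rwa [← f.comp_apply, ← hv, trace_vecMulVec] at this
  have h_boundary (u w) (hu : ‖u.1‖ = 1) (hw : ‖w.1‖ = 1) : v u = v w := by
    let b : C(Metric.sphere (0 : EuclideanSpace ℝ (Fin 2)) 1,
        Metric.closedBall (0 : EuclideanSpace ℝ (Fin 2)) 1) :=
      ⟨Set.inclusion Metric.sphere_subset_closedBall, continuous_inclusion _⟩
    have : PreconnectedSpace (Metric.sphere (0 : EuclideanSpace ℝ (Fin 2)) 1) :=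
      Subtype.preconnectedSpace (isPreconnected_sphere
        (by rw [← Module.finrank_eq_rank, finrank_euclideanSpace_fin]; norm_num) _ _)
    have h_b (z) : vecMulVec (v (b z)) (v (b z)) = vecMulVec (v w) (v w) := by
      have hz : ‖(b z).1‖ = 1 := mem_sphere_zero_iff_norm.1 z.2
      rw [hv, hv, f.comp_apply, f.comp_apply, diskToSphere_eq_of_norm_eq_one hz hw]
    have h_sq (z) : (v (b z) ⬝ᵥ v w) ^ 2 = 1 :=
      dotProduct_sq_eq_one_of_vecMulVec_self_eq (h_b z) (h_unit w)
    have h_cont : Continuous fun z => v (b z) ⬝ᵥ v w :=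
      (v.continuous.comp b.continuous).dotProduct continuous_const
    have h_one (z) : v (b z) ⬝ᵥ v w = 1 :=
      isPreconnected_univ.eq_of_sq_eq h_cont.continuousOn (g := fun _ => (1 : ℝ))
        continuousOn_const (fun z _ => by simpa using h_sq z) (fun _ => one_ne_zero)
        (Set.mem_univ ⟨w.1, mem_sphere_zero_iff_norm.2 hw⟩) (h_unit w) (Set.mem_univ z)
    exact eq_of_vecMulVec_self_eq (h_b ⟨u.1, mem_sphere_zero_iff_norm.2 hu⟩)
      (h_one ⟨u.1, mem_sphere_zero_iff_norm.2 hu⟩) (h_unit w)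
  have h_quot : Topology.IsQuotientMap diskToSphere :=
    .of_surjective_continuous diskToSphere_surjective diskToSphere.continuous
  have h_fac (u w) (huw : diskToSphere u = diskToSphere w) : v u = v w := by
    rcases eq_or_norm_eq_one_of_diskToSphere_eq huw with rfl | ⟨hu, hw⟩
    · rfl
    · exact h_boundary u w hu hw
  refine ⟨h_quot.lift v h_fac, fun x => ?_⟩
  obtain ⟨u, rfl⟩ := diskToSphere_surjective x
  have : h_quot.lift v h_fac (diskToSphere u) = v u :=
    DFunLike.congr_fun (h_quot.lift_comp v h_fac) u
  rw [this, hv, f.comp_apply]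

theorem exists_spherical_coordinates {x : EuclideanSpace ℝ (Fin 3)}
    (hx : x ∈ Metric.sphere (0 : EuclideanSpace ℝ (Fin 3)) 1) :
    ∃ θ φ : ℝ, !₂[Real.sin θ * Real.cos φ, Real.sin θ * Real.sin φ, Real.cos θ] = x := by
  rw [EuclideanSpace.mem_sphere_zero_one_fin_three] at hx
  have h_norm : ‖(⟨x 0, x 1⟩ : ℂ)‖ = √(1 - x 2 ^ 2) := by
    rw [Complex.norm_eq_sqrt_sq_add_sq]
    congr 1
    linarith
  have h_cos := Complex.norm_mul_cos_arg ⟨x 0, x 1⟩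
  have h_sin := Complex.norm_mul_sin_arg ⟨x 0, x 1⟩
  rw [h_norm, ← Real.sin_arccos] at h_cos h_sin
  refine ⟨Real.arccos (x 2), Complex.arg ⟨x 0, x 1⟩, ?_⟩
  ext i
  fin_cases i
  · simpa using h_cos
  · simpa using h_sin
  · simpa using Real.cos_arccos (by nlinarith [sq_nonneg (x 0), sq_nonneg (x 1)])
      (by nlinarith [sq_nonneg (x 0), sq_nonneg (x 1)])

/-- The cone over a smooth image of the two-sphere does not cover a four-dimensional space. -/
theorem exists_forall_smul_ne {p : EuclideanSpace ℝ (Fin 3) → Fin 4 → ℝ} (hp : ContDiff ℝ 1 p) :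
    ∃ w : Fin 4 → ℝ, ∀ x ∈ Metric.sphere (0 : EuclideanSpace ℝ (Fin 3)) 1, ∀ r : ℝ,
      r • p x ≠ w := by
  have h_coord : ContDiff ℝ 1 fun y : ℝ × ℝ × ℝ => (!₂[Real.sin y.2.1 * Real.cos y.2.2,
      Real.sin y.2.1 * Real.sin y.2.2, Real.cos y.2.1] : EuclideanSpace ℝ (Fin 3)) := by
    rw [contDiff_euclidean]
    intro i
    fin_cases i <;> simp <;> fun_prop
  have h_cone : ContDiff ℝ 1 fun y : ℝ × ℝ × ℝ => y.1 • p !₂[Real.sin y.2.1 * Real.cos y.2.2,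
      Real.sin y.2.1 * Real.sin y.2.2, Real.cos y.2.1] :=
    contDiff_fst.smul (hp.comp h_coord)
  obtain ⟨w, hw⟩ := (h_cone.dense_compl_range_of_finrank_lt_finrank (by simp)).nonempty
  refine ⟨w, fun x hx r hr => hw ?_⟩
  obtain ⟨θ, φ, rfl⟩ := exists_spherical_coordinates hx
  exact ⟨(r, θ, φ), hr⟩

theorem ContinuousMap.homotopic_of_segment_ne_zero {X E : Type*} [TopologicalSpace X]
    [AddCommGroup E] [Module ℝ E] [TopologicalSpace E] [ContinuousAdd E] [ContinuousSMul ℝ E]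
    (f g : C(X, {v : E // v ≠ 0}))
    (h : ∀ (t : unitInterval) (x : X), (1 - t : ℝ) • (f x : E) + (t : ℝ) • (g x : E) ≠ 0) :
    f.Homotopic g :=
  ⟨{ toFun := fun y => ⟨(1 - y.1 : ℝ) • (f y.2 : E) + (y.1 : ℝ) • (g y.2 : E), h y.1 y.2⟩
     continuous_toFun := by fun_prop
     map_zero_left := fun x => Subtype.ext (by simp)
     map_one_left := fun x => Subtype.ext (by simp) }⟩

/-- Maps from the two-sphere to a punctured four-dimensional space are nullhomotopic. -/
theorem ContinuousMap.nullhomotopic_of_sphere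
    (g : C(Metric.sphere (0 : EuclideanSpace ℝ (Fin 3)) 1, {v : Fin 4 → ℝ // v ≠ 0})) :
    g.Nullhomotopic := by
  obtain ⟨ε, hε, h_bound⟩ : ∃ ε > 0, ∀ x, ε ≤ ‖(g x : Fin 4 → ℝ)‖ := by
    have : Nonempty (Metric.sphere (0 : EuclideanSpace ℝ (Fin 3)) 1) :=
      (NormedSpace.sphere_nonempty.2 zero_le_one).to_subtype
    obtain ⟨x₀, -, hx₀⟩ := isCompact_univ.exists_isMinOn (Set.univ_nonempty)
      (f := fun x => ‖(g x : Fin 4 → ℝ)‖) (by fun_prop)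
    exact ⟨_, norm_pos_iff.2 (g x₀).2, fun x => hx₀ (Set.mem_univ x)⟩
  obtain ⟨G, hG⟩ := ContinuousMap.exists_restrict_eq Metric.isClosed_sphere
    ((⟨Subtype.val, continuous_subtype_val⟩ : C({v : Fin 4 → ℝ // v ≠ 0}, Fin 4 → ℝ)).comp g)
  have hG' (x) : G x.1 = (g x).1 := DFunLike.congr_fun hG x
  obtain ⟨p, hp, h_near, -⟩ := G.continuous.exists_contDiff_approx 1 (ε := fun _ => ε)
    continuous_const fun _ => hε
  have h_near' (x : Metric.sphere (0 : EuclideanSpace ℝ (Fin 3)) 1) : ‖p x - g x‖ < ‖(g x).1‖ := by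
    have := h_near x
    rw [hG', dist_eq_norm] at this
    exact this.trans_le (h_bound x)
  have h_seg (t : unitInterval) (x : Metric.sphere (0 : EuclideanSpace ℝ (Fin 3)) 1) :
      (1 - t : ℝ) • (g x).1 + (t : ℝ) • p x ≠ 0 := by
    intro h0
    have : (g x).1 = -((t : ℝ) • (p x - g x)) := by
      rw [eq_neg_iff_add_eq_zero]
      refine Eq.trans ?_ h0
      module
    have h_le : ‖(g x).1‖ ≤ ‖p x - g x‖ := by
      conv_lhs => rw [this, norm_neg, norm_smul, Real.norm_of_nonneg t.2.1]
      exact mul_le_of_le_one_left (norm_nonneg _) t.2.2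
    exact (h_near' x).not_ge h_le
  obtain ⟨w, hw⟩ := exists_forall_smul_ne hp
  have hw0 : w ≠ 0 := by
    obtain ⟨x, hx⟩ := (NormedSpace.sphere_nonempty (E := EuclideanSpace ℝ (Fin 3)) (x := 0)).2
      zero_le_one
    simpa using (hw x hx 0).symm
  have hp0 (x : Metric.sphere (0 : EuclideanSpace ℝ (Fin 3)) 1) : p x ≠ 0 := by
    simpa using h_seg 1 x
  let P : C(Metric.sphere (0 : EuclideanSpace ℝ (Fin 3)) 1, {v : Fin 4 → ℝ // v ≠ 0}) :=
    ⟨fun x => ⟨p x, hp0 x⟩, (hp.continuous.comp continuous_subtype_val).subtype_mk hp0⟩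
  refine ⟨⟨w, hw0⟩, (g.homotopic_of_segment_ne_zero P h_seg).trans
    (P.homotopic_of_segment_ne_zero _ fun t x h0 => ?_)⟩
  change (1 - t : ℝ) • p x + (t : ℝ) • w = 0 at h0
  rcases eq_or_ne (t : ℝ) 0 with ht | ht
  · rw [ht] at h0
    exact hp0 x (by simpa using h0)
  · refine hw x x.2 (-((t : ℝ)⁻¹ * (1 - t))) ?_
    rw [eq_neg_of_add_eq_zero_right (a := (1 - t : ℝ) • p x) (b := (t : ℝ) • w) h0 |>
      (eq_inv_smul_iff₀ ht).2]
    module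

/-- The Hopf map, sending a nonzero quaternion to the image of the north pole under the
corresponding rotation. -/
noncomputable def hopfMap :
    C({v : Fin 4 → ℝ // v ≠ 0}, Metric.sphere (0 : EuclideanSpace ℝ (Fin 3)) 1) where
  toFun v := ⟨(v.1 ⬝ᵥ v.1)⁻¹ • !₂[2 * (v.1 1 * v.1 3 + v.1 0 * v.1 2),
    2 * (v.1 2 * v.1 3 - v.1 0 * v.1 1), v.1 0 ^ 2 + v.1 3 ^ 2 - v.1 1 ^ 2 - v.1 2 ^ 2], by
      have h_ne : v.1 ⬝ᵥ v.1 ≠ 0 := mt dotProduct_self_eq_zero.1 v.2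
      rw [EuclideanSpace.mem_sphere_zero_one_fin_three]
      simp only [PiLp.smul_apply, smul_eq_mul, cons_val]
      field_simp
      simp only [dotProduct, Fin.sum_univ_four]
      ring⟩
  continuous_toFun := by
    have h_norm : Continuous fun v : {v : Fin 4 → ℝ // v ≠ 0} => v.1 ⬝ᵥ v.1 :=
      continuous_subtype_val.dotProduct continuous_subtype_val
    have h_vec : Continuous fun v : Fin 4 → ℝ =>
        (!₂[2 * (v 1 * v 3 + v 0 * v 2), 2 * (v 2 * v 3 - v 0 * v 1),
          v 0 ^ 2 + v 3 ^ 2 - v 1 ^ 2 - v 2 ^ 2] : EuclideanSpace ℝ (Fin 3)) :=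
      (PiLp.continuous_toLp 2 _).comp
        (continuous_pi fun i => by fin_cases i <;> simp <;> fun_prop)
    exact ((h_norm.inv₀ fun v => mt dotProduct_self_eq_zero.1 v.2).smul
      (h_vec.comp continuous_subtype_val)).subtype_mk _

/-- The half-turn of three-dimensional space around a nonzero vector. -/
noncomputable def halfTurn : C({v : Fin 3 → ℝ // v ≠ 0}, specialOrthogonalGroup (Fin 3) ℝ) where
  toFun v := ⟨(2 / (v.1 ⬝ᵥ v.1)) • vecMulVec v.1 v.1 - 1, by
    have h_ne : v.1 ⬝ᵥ v.1 ≠ 0 := mt dotProduct_self_eq_zero.1 v.2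
    rw [mem_specialOrthogonalGroup_iff, mem_orthogonalGroup_iff]
    constructor
    · rw [transpose_sub, transpose_smul, transpose_vecMulVec, transpose_one, sub_mul, mul_sub,
        mul_one, one_mul, Matrix.smul_mul, Matrix.mul_smul, vecMulVec_mul_vecMulVec,
        vecMulVec_smul]
      match_scalars <;> field_simp
      ring
    · rw [det_fin_three]
      simp [vecMulVec_apply]
      field_simp
      simp only [dotProduct, Fin.sum_univ_three]
      ring⟩
  continuous_toFun := by
    have h_norm : Continuous fun v : {v : Fin 3 → ℝ // v ≠ 0} => v.1 ⬝ᵥ v.1 :=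
      continuous_subtype_val.dotProduct continuous_subtype_val
    have h_vec : Continuous fun v : {v : Fin 3 → ℝ // v ≠ 0} => vecMulVec v.1 v.1 :=
      continuous_subtype_val.matrix_vecMulVec continuous_subtype_val
    exact (((continuous_const.div h_norm fun v => mt dotProduct_self_eq_zero.1 v.2).smul
      h_vec).sub continuous_const).subtype_mk _

theorem halfTurn_mulVec (v : {v : Fin 3 → ℝ // v ≠ 0}) (x : Fin 3 → ℝ) :
    (halfTurn v).1 *ᵥ x = (2 / (v.1 ⬝ᵥ v.1) * (v.1 ⬝ᵥ x)) • v.1 - x := by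
  change ((2 / (v.1 ⬝ᵥ v.1)) • vecMulVec v.1 v.1 - 1) *ᵥ x = _
  rw [sub_mulVec, smul_mulVec, vecMulVec_mulVec, one_mulVec, op_smul_eq_smul, smul_smul]

theorem halfTurn_mulVec_self (v : {v : Fin 3 → ℝ // v ≠ 0}) : (halfTurn v).1 *ᵥ v.1 = v.1 := by
  have h_ne : v.1 ⬝ᵥ v.1 ≠ 0 := mt dotProduct_self_eq_zero.1 v.2
  rw [halfTurn_mulVec, div_mul_cancel₀ _ h_ne, two_smul, add_sub_cancel_right]

theorem halfTurn_add_mulVec {a b : Fin 3 → ℝ} (hab : a + b ≠ 0) (h_norm : a ⬝ᵥ a = b ⬝ᵥ b) :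
    (halfTurn ⟨a + b, hab⟩).1 *ᵥ a = b := by
  have h_ne : (a + b) ⬝ᵥ (a + b) ≠ 0 := mt dotProduct_self_eq_zero.1 hab
  have h_two : (a + b) ⬝ᵥ (a + b) = 2 * ((a + b) ⬝ᵥ a) := by
    rw [dotProduct_add, add_dotProduct, add_dotProduct, dotProduct_comm b a]
    linarith
  rw [halfTurn_mulVec, div_mul_eq_mul_div, ← h_two, div_self h_ne, one_smul, add_sub_cancel_left]

theorem dotProduct_self_of_mem_sphere {x : EuclideanSpace ℝ (Fin 3)}
    (hx : x ∈ Metric.sphere (0 : EuclideanSpace ℝ (Fin 3)) 1) : x.ofLp ⬝ᵥ x.ofLp = 1 := by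
  rw [EuclideanSpace.mem_sphere_zero_one_fin_three] at hx
  rw [← hx, dotProduct, Fin.sum_univ_three]
  ring

theorem ofLp_ne_zero_of_mem_sphere {x : EuclideanSpace ℝ (Fin 3)}
    (hx : x ∈ Metric.sphere (0 : EuclideanSpace ℝ (Fin 3)) 1) : x.ofLp ≠ 0 := by
  intro h
  simpa [h] using dotProduct_self_of_mem_sphere hx

/-- Liftability to the rotation group is inherited by maps which are nowhere antipodal. -/
theorem exists_rotation_lift_of_add_ne_zero {X : Type*} [TopologicalSpace X]
    (f g : C(X, Metric.sphere (0 : EuclideanSpace ℝ (Fin 3)) 1))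
    (hfg : ∀ x, (f x).1.ofLp + (g x).1.ofLp ≠ 0) {u : Fin 3 → ℝ}
    (hf : ∃ A : C(X, specialOrthogonalGroup (Fin 3) ℝ), ∀ x, (A x).1 *ᵥ u = (f x).1.ofLp) :
    ∃ A : C(X, specialOrthogonalGroup (Fin 3) ℝ), ∀ x, (A x).1 *ᵥ u = (g x).1.ofLp := by
  obtain ⟨A, hA⟩ := hf
  have h_cont (f : C(X, Metric.sphere (0 : EuclideanSpace ℝ (Fin 3)) 1)) :
      Continuous fun x => (f x).1.ofLp :=
    (PiLp.continuous_ofLp 2 _).comp (continuous_subtype_val.comp f.continuous)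
  refine ⟨⟨fun x => halfTurn ⟨_, hfg x⟩ *
    (halfTurn ⟨_, ofLp_ne_zero_of_mem_sphere (f x).2⟩ * A x), ?_⟩, fun x => ?_⟩
  · exact (halfTurn.continuous.comp (((h_cont f).add (h_cont g)).subtype_mk _)).mul
      ((halfTurn.continuous.comp ((h_cont f).subtype_mk _)).mul A.continuous)
  · change ((halfTurn ⟨_, hfg x⟩).1 *
      ((halfTurn ⟨_, ofLp_ne_zero_of_mem_sphere (f x).2⟩).1 * (A x).1)) *ᵥ u = _
    rw [← mulVec_mulVec, ← mulVec_mulVec, hA]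
    conv_lhs => rw [halfTurn_mulVec_self ⟨_, ofLp_ne_zero_of_mem_sphere (f x).2⟩]
    exact halfTurn_add_mulVec _ ((dotProduct_self_of_mem_sphere (f x).2).trans
      (dotProduct_self_of_mem_sphere (g x).2).symm)

theorem exists_rotation_mulVec_eq {c : Fin 3 → ℝ} (hc : c ⬝ᵥ c = 1) :
    ∃ A : specialOrthogonalGroup (Fin 3) ℝ, A.1 *ᵥ ![0, 0, 1] = c := by
  by_cases h : (![0, 0, 1] : Fin 3 → ℝ) + c = 0
  · refine ⟨halfTurn ⟨![1, 0, 0], by simp⟩, ?_⟩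
    rw [halfTurn_mulVec, eq_neg_of_add_eq_zero_right h]
    simp
  · exact ⟨_, halfTurn_add_mulVec h (by simp [hc])⟩

theorem isOpen_setOf_add_ne_zero :
    IsOpen {y : Metric.sphere (0 : EuclideanSpace ℝ (Fin 3)) 1 ×
      Metric.sphere (0 : EuclideanSpace ℝ (Fin 3)) 1 | y.1.1.ofLp + y.2.1.ofLp ≠ 0} := by
  have h_cont : Continuous fun y : Metric.sphere (0 : EuclideanSpace ℝ (Fin 3)) 1 =>
      y.1.ofLp := (PiLp.continuous_ofLp 2 _).comp continuous_subtype_val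
  exact isOpen_ne_fun ((h_cont.comp continuous_fst).add (h_cont.comp continuous_snd))
    continuous_const

theorem exists_rotation_lift_of_homotopic_const {X : Type*} [TopologicalSpace X] [CompactSpace X]
    {σ : C(X, Metric.sphere (0 : EuclideanSpace ℝ (Fin 3)) 1)}
    {c : Metric.sphere (0 : EuclideanSpace ℝ (Fin 3)) 1}
    (h : σ.Homotopic (ContinuousMap.const _ c)) :
    ∃ A : C(X, specialOrthogonalGroup (Fin 3) ℝ),
      ∀ x, (A x).1 *ᵥ ![0, 0, 1] = (σ x).1.ofLp := by
  refine ContinuousMap.Homotopic.of_forall_mem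
    (Y := Metric.sphere (0 : EuclideanSpace ℝ (Fin 3)) 1)
    (Q := fun f => ∃ A : C(X, specialOrthogonalGroup (Fin 3) ℝ),
      ∀ x, (A x).1 *ᵥ ![0, 0, 1] = (f x).1.ofLp)
    isOpen_setOf_add_ne_zero (fun y h0 => ?_)
    (fun f g hfg hf => exists_rotation_lift_of_add_ne_zero f g hfg hf) h.symm ?_
  · rw [← two_smul ℝ] at h0
    exact smul_ne_zero two_ne_zero (ofLp_ne_zero_of_mem_sphere y.2) h0
  · obtain ⟨A, hA⟩ := exists_rotation_mulVec_eq (dotProduct_self_of_mem_sphere c.2)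
    exact ⟨ContinuousMap.const _ A, fun _ => hA⟩

theorem nullhomotopic_of_rotation_lift
    {σ : C(Metric.sphere (0 : EuclideanSpace ℝ (Fin 3)) 1,
      Metric.sphere (0 : EuclideanSpace ℝ (Fin 3)) 1)}
    {A : C(Metric.sphere (0 : EuclideanSpace ℝ (Fin 3)) 1, specialOrthogonalGroup (Fin 3) ℝ)}
    (hA : ∀ x, (A x).1 *ᵥ ![0, 0, 1] = (σ x).1.ofLp) : σ.Nullhomotopic := by
  obtain ⟨v, hv⟩ := exists_quaternion_lift_of_sphere A
  have h_norm (x) : v x ⬝ᵥ v x = 1 := by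
    rw [← trace_vecMulVec, hv, trace_quaternionMatrix]
  have h_ne (x) : v x ≠ 0 := fun h => by simpa [h] using h_norm x
  let g : C(Metric.sphere (0 : EuclideanSpace ℝ (Fin 3)) 1, {v : Fin 4 → ℝ // v ≠ 0}) :=
    ⟨fun x => ⟨v x, h_ne x⟩, v.continuous.subtype_mk h_ne⟩
  have h_comp : hopfMap.comp g = σ := by
    ext x i
    have h_entry (i j : Fin 4) : v x i * v x j = quaternionMatrix (A x).1 i j := by
      rw [← hv, vecMulVec_apply]
    have h_col := congrFun (hA x) i
    change ((v x ⬝ᵥ v x)⁻¹ • !₂[2 * (v x 1 * v x 3 + v x 0 * v x 2),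
      2 * (v x 2 * v x 3 - v x 0 * v x 1),
      v x 0 ^ 2 + v x 3 ^ 2 - v x 1 ^ 2 - v x 2 ^ 2]) i = (σ x).1.ofLp i
    rw [← h_col, h_norm, inv_one, one_smul]
    simp only [sq, h_entry]
    fin_cases i <;> simp [quaternionMatrix, mulVec, dotProduct, Fin.sum_univ_three] <;> ring
  rw [← h_comp]
  exact (ContinuousMap.nullhomotopic_of_sphere g).comp_right hopfMap

/-- A continuous map `σ : S² → S²` lifts through the quotient map
`q : SO(3) → S² = SO(2)\SO(3)`, `q(A) = A·e₃`, if and only if `σ` is homotopic to a constant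
map. -/
theorem so3_lift_iff_homotopic_to_const
    (σ : C(Metric.sphere (0 : EuclideanSpace ℝ (Fin 3)) 1,
          Metric.sphere (0 : EuclideanSpace ℝ (Fin 3)) 1)) :
    (∃ σhat : C(Metric.sphere (0 : EuclideanSpace ℝ (Fin 3)) 1,
        Matrix.specialOrthogonalGroup (Fin 3) ℝ),
      ∀ x : Metric.sphere (0 : EuclideanSpace ℝ (Fin 3)) 1,
        (WithLp.equiv 2 (Fin 3 → ℝ)).symm
            ((σhat x : Matrix (Fin 3) (Fin 3) ℝ) *ᵥ ![0, 0, 1]) =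
          (σ x : EuclideanSpace ℝ (Fin 3))) ↔
    ∃ c : Metric.sphere (0 : EuclideanSpace ℝ (Fin 3)) 1,
      ContinuousMap.Homotopic σ (ContinuousMap.const _ c) := by
  constructor
  · rintro ⟨A, hA⟩
    exact nullhomotopic_of_rotation_lift fun x => (WithLp.equiv 2 _).symm_apply_eq.1 (hA x)
  · rintro ⟨c, hc⟩
    obtain ⟨A, hA⟩ := exists_rotation_lift_of_homotopic_const hc
    exact ⟨A, fun x => (WithLp.equiv 2 _).symm_apply_eq.2 (hA x)⟩
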